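/- arXiv:2104.01134 — 2 statements merged into one kernel-verified Lean document; each statement's English description precedes it below -/
import Mathlib

section
/- Let $S_n$ be the number of simple chords in a uniformly random chord diagram of size $n \geq 1$ and let $\lambda_n = \frac{2n}{2n-1}$. Then $\left| P(S_n = 0) - e^{-\lambda_n} \right| \leq \frac{10}{n}$. -/
open MeasureTheory ProbabilityTheory Filter
open scoped Nat

instance {N : ℕ} : MeasurableSpace (Equiv.Perm (Fin N)) := ⊤

/-- A chord diagram of size `n` is a fixed-point-free involution of `{1,…,2n}`. -/
def IsChordDiagram {n : ℕ} (π : Equiv.Perm (Fin (2 * n))) : Prop :=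
  (∀ i, π (π i) = i) ∧ ∀ i, π i ≠ i

/-- The uniform probability measure on chord diagrams of size `n`. -/
noncomputable def uniformCD (n : ℕ) : Measure (Equiv.Perm (Fin (2 * n))) :=
  uniformOn {π | IsChordDiagram π}

/-- The number of crossings: quadruples `i < j < k < l` with `π i = k` and `π j = l`. -/
def crossings {n : ℕ} (π : Equiv.Perm (Fin (2 * n))) : ℕ :=
  ((Finset.univ : Finset (Fin (2 * n) × Fin (2 * n) × Fin (2 * n) × Fin (2 * n))).filter
    (fun q => q.1 < q.2.1 ∧ q.2.1 < q.2.2.1 ∧ q.2.2.1 < q.2.2.2 ∧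
      π q.1 = q.2.2.1 ∧ π q.2.1 = q.2.2.2)).card

/-- The number of simple chords: indices `k` with `π k = k + 1 (mod 2n)`. -/
def simpleChords {n : ℕ} (π : Equiv.Perm (Fin (2 * n))) : ℕ :=
  (Finset.univ.filter (fun k => π k = finRotate (2 * n) k)).card

section Matchings

open Finset Equiv

variable {α : Type*} [DecidableEq α]

/-- Conjugation by the transposition `(a b)`. -/
def conjSwap (a b : α) (π : Perm α) : Perm α :=
  swap a b * π * swap a b

lemma conjSwap_apply (a b : α) (π : Perm α) (i : α) :
    conjSwap a b π i = swap a b (π (swap a b i)) := rfl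

@[simp]
lemma conjSwap_conjSwap (a b : α) (π : Perm α) : conjSwap a b (conjSwap a b π) = π := by
  ext i
  simp [conjSwap_apply]

lemma conjSwap_comm (a b : α) (π : Perm α) : conjSwap a b π = conjSwap b a π := by
  simp [conjSwap, swap_comm]

lemma conjSwap_apply_of_ne {a b k : α} {π : Perm α} (ha : k ≠ a) (hb : k ≠ b)
    (hπ : π k = b) : conjSwap a b π k = a := by
  rw [conjSwap_apply, swap_apply_of_ne_of_ne ha hb, hπ, swap_apply_right]

variable [Fintype α]

/-- The fixed-point-free involutions of a finite type. -/
def matchings (α : Type*) [Fintype α] [DecidableEq α] : Finset (Perm α) :=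
  univ.filter fun π => (∀ i, π (π i) = i) ∧ ∀ i, π i ≠ i

/-- The points at which `π` agrees with `ρ`. -/
def agreement (ρ π : Perm α) : Finset α :=
  univ.filter fun i => π i = ρ i

lemma mem_matchings {π : Perm α} :
    π ∈ matchings α ↔ (∀ i, π (π i) = i) ∧ ∀ i, π i ≠ i := by
  simp [matchings]

lemma mem_agreement {ρ π : Perm α} {i : α} : i ∈ agreement ρ π ↔ π i = ρ i := by
  simp [agreement]

lemma conjSwap_mem_matchings {a b : α} {π : Perm α} (h : π ∈ matchings α) :
    conjSwap a b π ∈ matchings α := by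
  rw [mem_matchings] at h ⊢
  refine ⟨fun i => by simp [conjSwap_apply, h.1], fun i hi => h.2 (swap a b i) ?_⟩
  rwa [conjSwap_apply, swap_apply_eq_iff] at hi

lemma sum_conjSwap_filter {k b j : α} (hb : k ≠ b) (hj : k ≠ j) (F : Perm α → ℝ) :
    ∑ π ∈ (matchings α).filter (fun π => π k = j), F (conjSwap b j π) =
      ∑ π ∈ (matchings α).filter (fun π => π k = b), F π := by
  refine sum_nbij' (conjSwap b j) (conjSwap b j) ?_ ?_ (by simp) (by simp) (by simp)
  · intro π hπ
    rw [mem_filter] at hπ ⊢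
    exact ⟨conjSwap_mem_matchings hπ.1, conjSwap_apply_of_ne hb hj hπ.2⟩
  · intro π hπ
    rw [mem_filter] at hπ ⊢
    rw [conjSwap_comm]
    exact ⟨conjSwap_mem_matchings hπ.1, conjSwap_apply_of_ne hj hb hπ.2⟩

lemma sum_conjSwap {k b : α} (hb : k ≠ b) (F : Perm α → ℝ) :
    ∑ π ∈ matchings α, F (conjSwap b (π k) π) =
      ((Fintype.card α : ℝ) - 1) * ∑ π ∈ (matchings α).filter (fun π => π k = b), F π := by
  rw [← sum_fiberwise_of_maps_to (s := matchings α) (t := univ.erase k) (g := fun π => π k)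
    (fun π hπ => mem_erase.2 ⟨(mem_matchings.1 hπ).2 k, mem_univ _⟩)]
  have hfib : ∀ j ∈ univ.erase k,
      ∑ π ∈ (matchings α).filter (fun π => π k = j), F (conjSwap b (π k) π) =
        ∑ π ∈ (matchings α).filter (fun π => π k = b), F π := by
    intro j hj
    rw [← sum_conjSwap_filter hb (ne_of_mem_erase hj).symm F]
    exact sum_congr rfl fun π hπ => by rw [(mem_filter.1 hπ).2]
  have : 0 < Fintype.card α := Fintype.card_pos_iff.2 ⟨k⟩
  rw [sum_congr rfl hfib, sum_const, card_erase_of_mem (mem_univ k), card_univ, nsmul_eq_mul,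
    Nat.cast_sub this, Nat.cast_one]

lemma card_filter_apply_eq {k b : α} (hb : k ≠ b) :
    ((Fintype.card α : ℝ) - 1) * #((matchings α).filter fun π => π k = b) = #(matchings α) := by
  simpa using (sum_conjSwap hb fun _ => 1).symm

lemma card_filter_apply_apply_le {k j l m m' : α} (hkm : k ≠ m) (hjm : j ≠ m) (hkm' : k ≠ m')
    (hjm' : j ≠ m') (hlm : l ≠ m) (hlm' : l ≠ m') :
    #((matchings α).filter fun π => π k = j ∧ π l = m) ≤
      #((matchings α).filter fun π => π k = j ∧ π l = m') := by
  refine card_le_card_of_injOn (conjSwap m' m) ?_ fun π _ σ _ h => ?_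
  · intro π hπ
    simp only [coe_filter, Set.mem_ofPred_eq] at hπ ⊢
    refine ⟨conjSwap_mem_matchings hπ.1, ?_, conjSwap_apply_of_ne hlm' hlm hπ.2.2⟩
    rw [conjSwap_apply, swap_apply_of_ne_of_ne hkm' hkm, hπ.2.1,
      swap_apply_of_ne_of_ne hjm' hjm]
  · rw [← conjSwap_conjSwap m' m π, h, conjSwap_conjSwap]

lemma card_filter_two_le {k j l m : α} (hkj : k ≠ j) (hkl : k ≠ l) (hkm : k ≠ m) (hjl : j ≠ l)
    (hjm : j ≠ m) (hlm : l ≠ m) :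
    ((Fintype.card α : ℝ) - 3) * #((matchings α).filter fun π => π k = j ∧ π l = m) ≤
      #((matchings α).filter fun π => π k = j) := by
  have hcard : #(univ \ {k, j, l} : Finset α) + 3 = Fintype.card α := by
    have h3 : #({k, j, l} : Finset α) = 3 := card_eq_three.2 ⟨k, j, l, hkj, hkl, hjl, rfl⟩
    rw [← h3, card_sdiff_add_card_eq_card (subset_univ _), card_univ]
  have hmaps : ∀ π ∈ (matchings α).filter (fun π => π k = j),
      π l ∈ (univ \ {k, j, l} : Finset α) := by
    intro π hπ
    obtain ⟨hπ, hk⟩ := mem_filter.1 hπ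
    obtain ⟨hinv, hfix⟩ := mem_matchings.1 hπ
    simp only [Finset.mem_sdiff, mem_univ, true_and, mem_insert, mem_singleton, not_or]
    refine ⟨fun h => hjl ?_, fun h => hkl (π.injective (hk.trans h.symm)), hfix l⟩
    rw [← hk, ← h, hinv]
  have hsum : #(univ \ {k, j, l} : Finset α) *
      #((matchings α).filter fun π => π k = j ∧ π l = m) ≤
        #((matchings α).filter fun π => π k = j) := by
    rw [card_eq_sum_card_fiberwise hmaps, ← smul_eq_mul]
    refine card_nsmul_le_sum _ _ _ fun m' hm' => ?_
    simp only [Finset.mem_sdiff, mem_univ, true_and, mem_insert, mem_singleton, not_or] at hm'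
    rw [filter_filter]
    exact card_filter_apply_apply_le hkm hjm (Ne.symm hm'.1) (Ne.symm hm'.2.1) hlm
      (Ne.symm hm'.2.2)
  have : (Fintype.card α : ℝ) - 3 = #(univ \ {k, j, l} : Finset α) := by
    rw [← hcard]
    push_cast
    ring
  rw [this]
  exact_mod_cast hsum

/-- Under mild conditions on the partners of `k` and `ρ k`, re-pairing `k` with `ρ k`
creates exactly one new agreement with `ρ`. -/
lemma agreement_conjSwap {ρ π : Perm α} (hρ₂ : ∀ i, ρ (ρ i) ≠ i)
    (hπ : π ∈ matchings α) {k : α} (h₁ : π k ≠ ρ k) (h₂ : ρ (π k) ≠ k)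
    (h₃ : π (ρ k) ≠ ρ (ρ k)) (h₄ : π (ρ k) ≠ ρ (π k)) (h₅ : π k ≠ ρ (π (ρ k))) :
    #(agreement ρ (conjSwap (ρ k) (π k) π)) = #(agreement ρ π) + 1 := by
  obtain ⟨hinv, hfix⟩ := mem_matchings.1 hπ
  have hk : k ∉ agreement ρ π := by rwa [mem_agreement]
  rw [← card_insert_of_notMem hk]
  congr 1
  have hρ₁ : ∀ i, ρ i ≠ i := fun i h => hρ₂ i (by rw [h, h])
  ext i
  rw [mem_insert, mem_agreement, mem_agreement, conjSwap_apply]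
  by_cases hik : i = k
  · subst hik
    rw [swap_apply_of_ne_of_ne (hρ₁ i).symm (hfix i).symm, swap_apply_right]
    simp
  by_cases hi₁ : i = ρ k
  · subst hi₁
    rw [swap_apply_left, hinv, swap_apply_of_ne_of_ne (hρ₁ k).symm (hfix k).symm]
    have := hρ₂ k
    grind
  by_cases hi₂ : i = π k
  · subst hi₂
    rw [swap_apply_right, hinv, swap_apply_of_ne_of_ne (hfix _) (fun h => hρ₁ k (π.injective h))]
    grind
  rw [swap_apply_of_ne_of_ne hi₁ hi₂]
  by_cases hi₃ : i = π (ρ k)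
  · subst hi₃
    rw [hinv, swap_apply_left]
    have h : ρ k ≠ ρ (π (ρ k)) := fun h => hik (ρ.injective h.symm)
    grind
  have h : π i ≠ ρ k := fun h => hi₃ (by rw [← h, hinv])
  have h' : π i ≠ π k := fun h => hik (π.injective h)
  rw [swap_apply_of_ne_of_ne h h']
  simp [hik]

/-- The matchings for which re-pairing `k` with `ρ k` does not create exactly one new agreement
with `ρ`. -/
def exceptional (ρ : Perm α) (k : α) : Finset (Perm α) :=
  (matchings α).filter fun π => #(agreement ρ (conjSwap (ρ k) (π k) π)) ≠ #(agreement ρ π) + 1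

lemma exceptional_subset {ρ : Perm α} (hρ₂ : ∀ i, ρ (ρ i) ≠ i) (k : α) :
    exceptional ρ k ⊆
      ((matchings α).filter fun π => π k = ρ k) ∪
      ((matchings α).filter fun π => π k = ρ.symm k) ∪
      ((matchings α).filter fun π => π (ρ k) = ρ (ρ k)) ∪
      ((univ \ {k, ρ k, ρ.symm k}).biUnion fun j =>
        (matchings α).filter fun π => π k = j ∧ π (ρ k) = ρ j) ∪
      ((univ \ {k, ρ k, ρ.symm k}).biUnion fun j =>
        (matchings α).filter fun π => π k = ρ j ∧ π (ρ k) = j) := by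
  intro π hπ
  obtain ⟨hm, hne⟩ := mem_filter.1 hπ
  obtain ⟨hinv, hfix⟩ := mem_matchings.1 hm
  have hfix₁ := hfix k
  have hfix₂ := hfix (ρ k)
  have hinv₁ := hinv k
  have hinv₂ := hinv (ρ k)
  simp only [mem_union, mem_filter, mem_biUnion, Finset.mem_sdiff, mem_univ, true_and, mem_insert,
    mem_singleton, not_or, hm, Equiv.eq_symm_apply]
  by_contra! hcon
  obtain ⟨⟨⟨⟨h₁, h₂⟩, h₃⟩, h₄⟩, h₅⟩ := hcon
  refine hne (agreement_conjSwap hρ₂ hm h₁ h₂ h₃ ?_ ?_)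
  · exact h₄ (π k) ⟨hfix₁, h₁, h₂⟩ rfl
  · intro h
    exact h₅ (π (ρ k)) (by grind) h rfl

lemma card_exceptional_le {ρ : Perm α} (hρ₂ : ∀ i, ρ (ρ i) ≠ i)
    (hα : 3 < Fintype.card α) (k : α) :
    ((Fintype.card α : ℝ) - 1) * #(exceptional ρ k) ≤ 5 * #(matchings α) := by
  have hρ₁ : ∀ i, ρ i ≠ i := fun i h => hρ₂ i (by rw [h, h])
  have hsymm : ρ.symm k ≠ k := fun h => hρ₁ k (by rw [← h, Equiv.apply_symm_apply, h])
  have hsymm' : ρ k ≠ ρ.symm k := fun h => hρ₂ k (by rw [h, Equiv.apply_symm_apply])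
  have hM : (3 : ℝ) < Fintype.card α := by exact_mod_cast hα
  have hJ : (#(univ \ {k, ρ k, ρ.symm k} : Finset α) : ℝ) = (Fintype.card α : ℝ) - 3 := by
    have h3 : #({k, ρ k, ρ.symm k} : Finset α) = 3 :=
      card_eq_three.2 ⟨k, _, _, (hρ₁ k).symm, hsymm.symm, hsymm', rfl⟩
    have := card_sdiff_add_card_eq_card (subset_univ ({k, ρ k, ρ.symm k} : Finset α))
    rw [h3, card_univ] at this
    rw [← this]
    push_cast
    ring
  have hpair : ∀ f g : α → α,
      (∀ j ∈ (univ \ {k, ρ k, ρ.symm k} : Finset α), k ≠ f j ∧ k ≠ g j ∧ f j ≠ ρ k ∧ f j ≠ g j ∧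
        ρ k ≠ g j) →
      ((Fintype.card α : ℝ) - 1) * #((univ \ {k, ρ k, ρ.symm k}).biUnion fun j =>
        (matchings α).filter fun π => π k = f j ∧ π (ρ k) = g j) ≤ #(matchings α) := by
    intro f g hfg
    set J : Finset α := univ \ {k, ρ k, ρ.symm k}
    have hterm : ∀ j ∈ J, ((Fintype.card α : ℝ) - 1) *
        #((matchings α).filter fun π => π k = f j ∧ π (ρ k) = g j) ≤
          #(matchings α) / ((Fintype.card α : ℝ) - 3) := by
      intro j hj
      obtain ⟨h₁, h₂, h₃, h₄, h₅⟩ := hfg j hj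
      rw [le_div_iff₀ (by linarith), ← card_filter_apply_eq h₁, mul_assoc,
        mul_comm (Nat.cast _) (_ - _)]
      exact mul_le_mul_of_nonneg_left
        (card_filter_two_le h₁ (hρ₁ k).symm h₂ h₃ h₄ h₅) (by linarith)
    calc ((Fintype.card α : ℝ) - 1) * #(J.biUnion fun j =>
          (matchings α).filter fun π => π k = f j ∧ π (ρ k) = g j)
        ≤ ((Fintype.card α : ℝ) - 1) * ∑ j ∈ J,
          (#((matchings α).filter fun π => π k = f j ∧ π (ρ k) = g j) : ℝ) := by
          refine mul_le_mul_of_nonneg_left ?_ (by linarith)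
          exact_mod_cast card_biUnion_le
      _ ≤ ∑ j ∈ J, (#(matchings α) : ℝ) / ((Fintype.card α : ℝ) - 3) := by
          rw [mul_sum]
          exact sum_le_sum hterm
      _ = #(matchings α) := by
          rw [sum_const, nsmul_eq_mul, hJ, mul_div_cancel₀ _ (by linarith)]
  have h₁ := card_filter_apply_eq (hρ₁ k).symm
  have h₂ := card_filter_apply_eq hsymm.symm
  have h₃ := card_filter_apply_eq (hρ₁ (ρ k)).symm
  have h₄ := hpair id ρ (by
    intro j hj
    simp only [Finset.mem_sdiff, mem_univ, true_and, mem_insert, mem_singleton, not_or,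
      Equiv.eq_symm_apply] at hj
    exact ⟨Ne.symm hj.1, Ne.symm hj.2.2, hj.2.1, (hρ₁ j).symm,
      fun h => hj.1 (ρ.injective h).symm⟩)
  have h₅ := hpair ρ id (by
    intro j hj
    simp only [Finset.mem_sdiff, mem_univ, true_and, mem_insert, mem_singleton, not_or,
      Equiv.eq_symm_apply] at hj
    exact ⟨Ne.symm hj.2.2, Ne.symm hj.1, fun h => hj.1 (ρ.injective h), hρ₁ j,
      Ne.symm hj.2.1⟩)
  have hcard : (#(exceptional ρ k) : ℝ) ≤ _ := Nat.cast_le.2 <|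
    (card_le_card (exceptional_subset hρ₂ k)).trans <| (card_union_le _ _).trans <|
      Nat.add_le_add_right ((card_union_le _ _).trans <|
        Nat.add_le_add_right ((card_union_le _ _).trans <|
          Nat.add_le_add_right (card_union_le _ _) _) _) _
  push_cast at hcard
  have := mul_le_mul_of_nonneg_left hcard (by linarith : (0 : ℝ) ≤ (Fintype.card α : ℝ) - 1)
  simp only [id] at h₄ h₅
  linarith

lemma abs_pow_sub_pow_le_one {u : ℝ} (h₀ : 0 ≤ u) (h₁ : u ≤ 1) (a b : ℕ) :
    |u ^ a - u ^ b| ≤ 1 := by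
  rw [abs_le]
  have := pow_nonneg h₀ a
  have := pow_nonneg h₀ b
  have := pow_le_one₀ (n := a) h₀ h₁
  have := pow_le_one₀ (n := b) h₀ h₁
  constructor <;> linarith

/-- The derivative of the generating function of the number of agreements with `ρ`, as a sum over
re-paired matchings. -/
lemma sum_card_agreement_mul_pow {ρ : Perm α} (hρ₁ : ∀ i, ρ i ≠ i) (u : ℝ) :
    ((Fintype.card α : ℝ) - 1) *
        ∑ π ∈ matchings α, (#(agreement ρ π) : ℝ) * u ^ (#(agreement ρ π) - 1) =
      ∑ k, ∑ π ∈ matchings α, u ^ (#(agreement ρ (conjSwap (ρ k) (π k) π)) - 1) := by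
  have hcount : ∀ π : Perm α, (#(agreement ρ π) : ℝ) * u ^ (#(agreement ρ π) - 1) =
      ∑ k, if π k = ρ k then u ^ (#(agreement ρ π) - 1) else 0 := by
    intro π
    rw [← sum_filter, sum_const, nsmul_eq_mul]
    rfl
  rw [sum_congr rfl fun π _ => hcount π, sum_comm, mul_sum]
  refine sum_congr rfl fun k _ => ?_
  rw [sum_conjSwap (hρ₁ k).symm fun π => u ^ (#(agreement ρ π) - 1), sum_filter]

lemma abs_deriv_sub_le {ρ : Perm α} (hρ₂ : ∀ i, ρ (ρ i) ≠ i) (hα : 3 < Fintype.card α)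
    {u : ℝ} (h₀ : 0 ≤ u) (h₁ : u ≤ 1) :
    |∑ π ∈ matchings α, (#(agreement ρ π) : ℝ) * u ^ (#(agreement ρ π) - 1) -
        (Fintype.card α : ℝ) / ((Fintype.card α : ℝ) - 1) *
          ∑ π ∈ matchings α, u ^ #(agreement ρ π)| ≤
      5 * Fintype.card α / ((Fintype.card α : ℝ) - 1) ^ 2 * #(matchings α) := by
  have hρ₁ : ∀ i, ρ i ≠ i := fun i h => hρ₂ i (by rw [h, h])
  have hM : (0 : ℝ) < (Fintype.card α : ℝ) - 1 := by
    have : (3 : ℝ) < Fintype.card α := by exact_mod_cast hα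
    linarith
  have hterm : ∀ k : α, |∑ π ∈ matchings α,
      (u ^ (#(agreement ρ (conjSwap (ρ k) (π k) π)) - 1) - u ^ #(agreement ρ π))| ≤
        5 * #(matchings α) / ((Fintype.card α : ℝ) - 1) := by
    intro k
    have hle : |∑ π ∈ matchings α,
        (u ^ (#(agreement ρ (conjSwap (ρ k) (π k) π)) - 1) - u ^ #(agreement ρ π))| ≤
          #(exceptional ρ k) := by
      refine (abs_sum_le_sum_abs _ _).trans ?_
      rw [exceptional, card_filter, Nat.cast_sum]
      refine sum_le_sum fun π _ => ?_
      split_ifs with h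
      · exact_mod_cast abs_pow_sub_pow_le_one h₀ h₁ _ _
      · rw [not_not] at h
        simp [h]
    rw [le_div_iff₀ hM, mul_comm]
    exact (mul_le_mul_of_nonneg_left hle hM.le).trans (card_exceptional_le hρ₂ hα k)
  have hdiff : ((Fintype.card α : ℝ) - 1) *
      (∑ π ∈ matchings α, (#(agreement ρ π) : ℝ) * u ^ (#(agreement ρ π) - 1) -
        (Fintype.card α : ℝ) / ((Fintype.card α : ℝ) - 1) *
          ∑ π ∈ matchings α, u ^ #(agreement ρ π)) =
      ∑ k, ∑ π ∈ matchings α,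
        (u ^ (#(agreement ρ (conjSwap (ρ k) (π k) π)) - 1) - u ^ #(agreement ρ π)) := by
    simp_rw [sum_sub_distrib]
    rw [mul_sub, sum_card_agreement_mul_pow hρ₁, sum_const, nsmul_eq_mul, card_univ]
    field_simp
  have hbound : ((Fintype.card α : ℝ) - 1) *
      |∑ π ∈ matchings α, (#(agreement ρ π) : ℝ) * u ^ (#(agreement ρ π) - 1) -
        (Fintype.card α : ℝ) / ((Fintype.card α : ℝ) - 1) *
          ∑ π ∈ matchings α, u ^ #(agreement ρ π)| ≤
      Fintype.card α * (5 * #(matchings α) / ((Fintype.card α : ℝ) - 1)) := by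
    rw [← abs_of_pos hM, ← abs_mul, abs_of_pos hM, hdiff]
    refine (abs_sum_le_sum_abs _ _).trans ((sum_le_sum fun k _ => hterm k).trans_eq ?_)
    rw [sum_const, nsmul_eq_mul, card_univ]
  rw [← le_div_iff₀' hM] at hbound
  refine hbound.trans_eq ?_
  field_simp

/-- If `g' - c g` is at most `δ` on `[0, 1]`, then `g 0` is within `δ` of `g 1 * exp (-c)`. -/
lemma abs_sub_mul_exp_neg_le {g g' : ℝ → ℝ} {c δ : ℝ} (hc : 0 ≤ c)
    (hg : ∀ u, HasDerivAt g (g' u) u)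
    (hδ : ∀ u, 0 ≤ u → u ≤ 1 → |g' u - c * g u| ≤ δ) :
    |g 0 - g 1 * Real.exp (-c)| ≤ δ := by
  have hderiv : ∀ u, HasDerivAt (fun u => g u * Real.exp (-c * u))
      ((g' u - c * g u) * Real.exp (-c * u)) u := by
    intro u
    have hexp : HasDerivAt (fun u : ℝ => Real.exp (-c * u)) (Real.exp (-c * u) * (-c)) u := by
      simpa using ((hasDerivAt_id u).const_mul (-c)).exp
    exact ((hg u).mul hexp).congr_deriv (by ring)
  have := norm_image_sub_le_of_norm_deriv_le_segment_01'
    (fun u _ => (hderiv u).hasDerivWithinAt) (C := δ) (fun u hu => by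
      rw [norm_mul, Real.norm_eq_abs, Real.norm_eq_abs, Real.abs_exp]
      have h := hδ u hu.1 hu.2.le
      have hexp : Real.exp (-c * u) ≤ 1 :=
        Real.exp_le_one_iff.2 (by nlinarith [mul_nonneg hc hu.1])
      exact (mul_le_of_le_one_right (abs_nonneg _) hexp).trans h)
  rw [abs_sub_comm]
  simpa using this

lemma abs_card_agreement_eq_zero_sub_le {ρ : Perm α} (hρ₂ : ∀ i, ρ (ρ i) ≠ i)
    (hα : 3 < Fintype.card α) :
    |(#((matchings α).filter fun π => #(agreement ρ π) = 0) : ℝ) -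
        #(matchings α) * Real.exp (-((Fintype.card α : ℝ) / ((Fintype.card α : ℝ) - 1)))| ≤
      5 * Fintype.card α / ((Fintype.card α : ℝ) - 1) ^ 2 * #(matchings α) := by
  have hM : (3 : ℝ) < Fintype.card α := by exact_mod_cast hα
  have := abs_sub_mul_exp_neg_le
    (g := fun u => ∑ π ∈ matchings α, u ^ #(agreement ρ π))
    (div_nonneg (Nat.cast_nonneg (Fintype.card α))
      (by linarith : (0 : ℝ) ≤ (Fintype.card α : ℝ) - 1))
    (fun u => HasDerivAt.fun_sum fun π _ => hasDerivAt_pow _ u)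
    (fun u h₀ h₁ => abs_deriv_sub_le hρ₂ hα h₀ h₁)
  simpa only [zero_pow_eq, sum_boole, one_pow, sum_const, nsmul_eq_mul, mul_one] using this

end Matchings

lemma matchings_fin_nonempty (n : ℕ) : (matchings (Fin (2 * n))).Nonempty := by
  refine ⟨Fin.revPerm, mem_matchings.2 ⟨by simp, fun i h => ?_⟩⟩
  have := congrArg Fin.val h
  simp only [Fin.revPerm_apply, Fin.val_rev] at this
  omega

lemma finRotate_finRotate_ne {m : ℕ} (hm : 2 < m) (i : Fin m) :
    finRotate m (finRotate m i) ≠ i := by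
  obtain ⟨m, rfl⟩ : ∃ k, m = k + 1 := ⟨m - 1, by omega⟩
  intro h
  have := congrArg Fin.val h
  simp only [coe_finRotate, Fin.ext_iff, Fin.val_last] at this
  split_ifs at this <;> omega

lemma uniformCD_simpleChords_eq_zero (n : ℕ) :
    ((uniformCD n) {π | simpleChords π = 0}).toReal =
      (((matchings (Fin (2 * n))).filter
        fun π => (agreement (finRotate (2 * n)) π).card = 0).card : ℝ) /
        (matchings (Fin (2 * n))).card := by
  have : MeasurableSingletonClass (Equiv.Perm (Fin (2 * n))) := ⟨fun _ => trivial⟩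
  have hs : {π : Equiv.Perm (Fin (2 * n)) | IsChordDiagram π} = ↑(matchings (Fin (2 * n))) := by
    ext π
    simp [mem_matchings, IsChordDiagram]
  have ht : {π : Equiv.Perm (Fin (2 * n)) | simpleChords π = 0} =
      ↑(Finset.univ.filter fun π : Equiv.Perm (Fin (2 * n)) =>
        (agreement (finRotate (2 * n)) π).card = 0) := by
    ext π
    simp [simpleChords, agreement]
  rw [uniformCD, hs, ht, uniformOn_apply_finset, ENNReal.toReal_div, ENNReal.toReal_natCast,
    ENNReal.toReal_natCast, Finset.inter_filter, Finset.inter_univ]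

/-- `|P(Sₙ = 0) - e^{-λₙ}| ≤ 10/n` where `λₙ = 2n/(2n-1)`. -/
theorem simpleChords_zero_prob_bound (n : ℕ) (hn : 1 ≤ n) :
    |((uniformCD n) {π | simpleChords π = 0}).toReal -
        Real.exp (-(2 * (n : ℝ) / (2 * (n : ℝ) - 1)))| ≤ 10 / n := by
  have hN : (0 : ℝ) < (matchings (Fin (2 * n))).card :=
    Nat.cast_pos.2 (matchings_fin_nonempty n).card_pos
  rw [uniformCD_simpleChords_eq_zero]
  obtain rfl | hn := hn.eq_or_lt
  · have hle : (((matchings (Fin (2 * 1))).filter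
        fun π => (agreement (finRotate (2 * 1)) π).card = 0).card : ℝ) /
        (matchings (Fin (2 * 1))).card ≤ 1 :=
      div_le_one_of_le₀ (Nat.cast_le.2 (Finset.card_filter_le _ _)) hN.le
    have hge : (0 : ℝ) ≤ (((matchings (Fin (2 * 1))).filter
        fun π => (agreement (finRotate (2 * 1)) π).card = 0).card : ℝ) /
        (matchings (Fin (2 * 1))).card := by positivity
    have hexp := Real.exp_pos (-(2 * ((1 : ℕ) : ℝ) / (2 * ((1 : ℕ) : ℝ) - 1)))
    have hexp' : Real.exp (-(2 * ((1 : ℕ) : ℝ) / (2 * ((1 : ℕ) : ℝ) - 1))) ≤ 1 :=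
      Real.exp_le_one_iff.2 (by norm_num)
    have h10 : (10 : ℝ) / ((1 : ℕ) : ℝ) = 10 := by norm_num
    rw [h10, abs_le]
    constructor <;> linarith
  · have hn' : (2 : ℝ) ≤ n := by exact_mod_cast hn
    have h := abs_card_agreement_eq_zero_sub_le
      (finRotate_finRotate_ne (m := 2 * n) (by omega)) (by rw [Fintype.card_fin]; omega)
    rw [Fintype.card_fin, Nat.cast_mul, Nat.cast_ofNat] at h
    have hbound : 5 * (2 * (n : ℝ)) / (2 * (n : ℝ) - 1) ^ 2 ≤ 10 / n := by
      rw [div_le_div_iff₀ (by nlinarith) (by linarith)]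
      nlinarith
    rw [← mul_le_mul_iff_left₀ hN, ← abs_of_pos hN, ← abs_mul, abs_of_pos hN, sub_mul,
      div_mul_cancel₀ _ hN.ne', mul_comm (Real.exp _)]
    exact h.trans (mul_le_mul_of_nonneg_right hbound hN.le)
end

section
/- Let $S_n$ be the number of simple chords in a uniformly random chord diagram of size $n$. Then $S_n$ converges in distribution to a Poisson random variable with mean $1$: for every non-negative integer $k$, $P(S_n = k) \to \frac{e^{-1}}{k!}$ as $n \to \infty$. -/
open MeasureTheory ProbabilityTheory Filter
open scoped Nat

section FixedPointFreeInvolutions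

open Finset

variable {α : Type*} [Fintype α] [DecidableEq α]

/-- The fixed-point-free involutions of a finite type. -/
def fpfInvolutions (α : Type*) [Fintype α] [DecidableEq α] : Finset (Equiv.Perm α) :=
  {π | (∀ i, π (π i) = i) ∧ ∀ i, π i ≠ i}

theorem mem_fpfInvolutions {π : Equiv.Perm α} :
    π ∈ fpfInvolutions α ↔ (∀ i, π (π i) = i) ∧ ∀ i, π i ≠ i := by
  simp [fpfInvolutions]

/-- The fixed-point-free involutions agreeing with `g` on `A`. -/
def fpfExtensions (g : α → α) (A : Finset α) : Finset (Equiv.Perm α) :=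
  {π ∈ fpfInvolutions α | ∀ i ∈ A, π i = g i}

theorem card_fpfExtensions_fiber_le (g : α → α) {A : Finset α} {x y z : α}
    (hyA : y ∉ A) (hzA : z ∉ A) (hyg : y ∉ A.image g) (hzg : z ∉ A.image g)
    (hyx : y ≠ x) (hzx : z ≠ x) :
    #{π ∈ fpfExtensions g A | π x = y} ≤ #{π ∈ fpfExtensions g A | π x = z} := by
  refine card_le_card_of_injOn (fun π => Equiv.swap y z * π * Equiv.swap y z) ?_ ?_
  · intro π hπ
    simp only [fpfExtensions, mem_fpfInvolutions, coe_filter, mem_filter, Set.mem_ofPred_eq,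
      Equiv.Perm.mul_apply] at hπ ⊢
    obtain ⟨⟨⟨hinv, hfix⟩, hg⟩, hxy⟩ := hπ
    refine ⟨⟨⟨fun i => by simp [hinv], fun i h => hfix (Equiv.swap y z i) ?_⟩, fun i hi => ?_⟩, ?_⟩
    · rw [← Equiv.swap_apply_self y z (π _), h]
    · rw [Equiv.swap_apply_of_ne_of_ne (ne_of_mem_of_not_mem hi hyA)
        (ne_of_mem_of_not_mem hi hzA), hg i hi, Equiv.swap_apply_of_ne_of_ne
        (ne_of_mem_of_not_mem (mem_image_of_mem g hi) hyg)
        (ne_of_mem_of_not_mem (mem_image_of_mem g hi) hzg)]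
    · rw [Equiv.swap_apply_of_ne_of_ne hyx.symm hzx.symm, hxy, Equiv.swap_apply_left]
  · intro π _ σ _ h
    simpa using h

/-- Prescribing one more chord divides the number of diagrams by the number of possible partners
of the new point. -/
theorem card_fpfExtensions_eq_mul_insert {g : α → α} (hg : Function.Injective g) {A : Finset α}
    {x : α} (hx : x ∉ A) (hA : ∀ i ∈ insert x A, g i ∉ insert x A) :
    #(fpfExtensions g A) =
      (Fintype.card α - (2 * #A + 1)) * #(fpfExtensions g (insert x A)) := by
  have hxg : x ∉ A.image g := by
    rintro h
    obtain ⟨a, ha, rfl⟩ := mem_image.1 h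
    exact hA a (mem_insert_of_mem ha) (mem_insert_self _ _)
  have hdisj : Disjoint A (A.image g) := by
    rw [disjoint_right]
    intro b hb hbA
    obtain ⟨a, ha, rfl⟩ := mem_image.1 hb
    exact hA a (mem_insert_of_mem ha) (mem_insert_of_mem hbA)
  have hgx := hA x (mem_insert_self _ _)
  rw [mem_insert, not_or] at hgx
  have hgxg : g x ∉ A.image g := by rwa [hg.mem_finset_image]
  have hmaps : (fpfExtensions g A : Set (Equiv.Perm α)).MapsTo (fun π => π x)
      ((insert x (A ∪ A.image g))ᶜ : Finset α) := by
    intro π hπ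
    simp only [fpfExtensions, mem_fpfInvolutions, coe_filter,
      Set.mem_ofPred_eq] at hπ
    obtain ⟨⟨hinv, hfix⟩, hπg⟩ := hπ
    simp only [mem_coe, mem_compl, mem_insert, mem_union, not_or]
    refine ⟨hfix x, fun h => hxg ?_, fun h => ?_⟩
    · exact mem_image.2 ⟨π x, h, by rw [← hπg _ h, hinv]⟩
    · obtain ⟨a, ha, hax⟩ := mem_image.1 h
      rw [← hπg a ha] at hax
      exact hx (π.injective hax ▸ ha)
  have hinsert : {π ∈ fpfExtensions g A | π x = g x} = fpfExtensions g (insert x A) := by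
    ext π
    simp only [fpfExtensions, mem_filter, forall_mem_insert]
    tauto
  rw [card_eq_sum_card_fiberwise (f := fun π : Equiv.Perm α => π x)
    (t := (insert x (A ∪ A.image g))ᶜ) hmaps,
    sum_const_nat (m := #(fpfExtensions g (insert x A)))]
  · rw [card_compl, card_insert_of_notMem (by simp only [mem_union]; tauto),
      card_union_of_disjoint hdisj, card_image_of_injective _ hg, two_mul]
  · intro y hy
    simp only [mem_compl, mem_insert, mem_union, not_or] at hy
    rw [← hinsert]
    exact le_antisymm
      (card_fpfExtensions_fiber_le g hy.2.1 hgx.2 hy.2.2 hgxg hy.1 hgx.1)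
      (card_fpfExtensions_fiber_le g hgx.2 hy.2.1 hgxg hy.2.2 hgx.1 hy.1)

theorem card_fpfExtensions_mul_prod {g : α → α} (hg : Function.Injective g) {A : Finset α}
    (hA : ∀ i ∈ A, g i ∉ A) :
    (∏ i ∈ range #A, (Fintype.card α - (2 * i + 1))) * #(fpfExtensions g A) =
      #(fpfInvolutions α) := by
  induction A using Finset.induction_on with
  | empty => simp [fpfExtensions]
  | insert x A hx ih =>
    rw [← ih fun i hi h => hA i (mem_insert_of_mem hi) (mem_insert_of_mem h),
      card_insert_of_notMem hx, prod_range_succ, mul_assoc,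
      ← card_fpfExtensions_eq_mul_insert hg hx hA]

theorem fpfExtensions_eq_empty {g : α → α} (hgg : ∀ i, g (g i) ≠ i) {A : Finset α}
    (hA : ¬ ∀ i ∈ A, g i ∉ A) : fpfExtensions g A = ∅ := by
  push Not at hA
  obtain ⟨i, hi, hgi⟩ := hA
  refine filter_eq_empty_iff.2 fun π hπ h => hgg i ?_
  rw [← h _ hgi, ← h _ hi, (mem_fpfInvolutions.1 hπ).1]

/-- The sets of `m` points that are disjoint from their image under `g`. -/
def separatedSets (g : α → α) (m : ℕ) : Finset (Finset α) :=
  {A ∈ powersetCard m univ | ∀ i ∈ A, g i ∉ A}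

/-- The factorial moments of the number of points where a fixed-point-free involution agrees
with `g`. -/
theorem sum_choose_card_agree {g : α → α} (hg : Function.Injective g) (hgg : ∀ i, g (g i) ≠ i)
    (m : ℕ) :
    (∏ i ∈ range m, (Fintype.card α - (2 * i + 1))) *
        ∑ π ∈ fpfInvolutions α, (#{k | π k = g k}).choose m =
      #(separatedSets g m) * #(fpfInvolutions α) := by
  have hcount : ∑ π ∈ fpfInvolutions α, (#{k | π k = g k}).choose m =
      ∑ A ∈ powersetCard m univ, #(fpfExtensions g A) := by
    convert sum_card_bipartiteAbove_eq_sum_card_bipartiteBelow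
      (s := fpfInvolutions α) (t := powersetCard m (univ : Finset α))
      (fun π A => ∀ i ∈ A, π i = g i) using 2 with π _ A _
    swap; · rfl
    rw [← card_powersetCard]
    congr 1
    ext A
    simp only [mem_powersetCard, bipartiteAbove, mem_filter, subset_iff, mem_univ,
      true_and]
    tauto
  rw [hcount, mul_sum, separatedSets, card_filter, sum_mul]
  refine sum_congr rfl fun A hA => ?_
  split_ifs with h
  · rw [← (mem_powersetCard.1 hA).2, card_fpfExtensions_mul_prod hg h, one_mul]
  · simp [fpfExtensions_eq_empty hgg h]

theorem card_not_separated_le {g : α → α} (hgi : ∀ i, g i ≠ i) (m : ℕ) :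
    #{A ∈ powersetCard (m + 1) (univ : Finset α) | ¬ ∀ i ∈ A, g i ∉ A} ≤
      (Fintype.card α).choose m * m := by
  calc _ ≤ #((powersetCard m (univ : Finset α)).biUnion
        fun B => B.image fun j => insert (g j) B) := by
        refine card_le_card fun A hA => ?_
        simp only [mem_filter, mem_powersetCard_univ] at hA
        obtain ⟨hA, h⟩ := hA
        push Not at h
        obtain ⟨i, hi, hgA⟩ := h
        simp only [mem_biUnion, mem_powersetCard_univ, mem_image]
        exact ⟨A.erase (g i), by rw [card_erase_of_mem hgA, hA, Nat.add_sub_cancel], i,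
          mem_erase.2 ⟨(hgi i).symm, hi⟩, insert_erase hgA⟩
    _ ≤ #(powersetCard m (univ : Finset α)) * m := by
        refine card_biUnion_le_card_mul _ _ _ fun B hB => card_image_le.trans ?_
        rw [(mem_powersetCard.1 hB).2]
    _ = _ := by rw [card_powersetCard, card_univ]

theorem card_separatedSets_le (g : α → α) (m : ℕ) :
    #(separatedSets g m) ≤ (Fintype.card α).choose m :=
  (card_filter_le _ _).trans (by rw [card_powersetCard, card_univ])

theorem choose_le_card_separatedSets_add {g : α → α} (hgi : ∀ i, g i ≠ i) (m : ℕ) :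
    (Fintype.card α).choose (m + 1) ≤
      #(separatedSets g (m + 1)) + (Fintype.card α).choose m * m := by
  rw [← card_univ, ← card_powersetCard, ← card_filter_add_card_filter_not
    (s := powersetCard (m + 1) (univ : Finset α)) (fun A => ∀ i ∈ A, g i ∉ A)]
  exact Nat.add_le_add_left (card_not_separated_le hgi m) _

end FixedPointFreeInvolutions

section Bonferroni

open Finset

theorem abs_ite_sub_alternating_sum_choose_le (s k r : ℕ) :
    |(if s = k then 1 else 0 : ℝ) -
      ∑ i ∈ range (r + 1), (-1) ^ i * ((k + i).choose k * s.choose (k + i) : ℝ)| ≤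
      (k + r).choose k * s.choose (k + r) := by
  have hmul (i : ℕ) : ((k + i).choose k * s.choose (k + i) : ℝ) =
      s.choose k * (s - k).choose i := by
    have := Nat.choose_mul (n := s) (k := k + i) (s := k) (by lia)
    rw [Nat.add_sub_cancel_left, mul_comm] at this
    exact_mod_cast this
  simp only [hmul]
  have hsum : ∑ i ∈ range (r + 1), (-1 : ℝ) ^ i * (s.choose k * (s - k).choose i : ℝ) =
      s.choose k * ∑ i ∈ range (r + 1), (-1 : ℝ) ^ i * ((s - k).choose i : ℝ) := by
    rw [mul_sum]
    exact sum_congr rfl fun i _ => by ring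
  rw [hsum]
  rcases lt_trichotomy s k with h | rfl | h
  · simp [h.ne, Nat.choose_eq_zero_of_lt h]
  · have : ∑ i ∈ range (r + 1), (-1 : ℝ) ^ i * ((0 : ℕ).choose i : ℝ) = 1 := by
      rw [sum_range_succ']
      simp
    rw [Nat.sub_self, this]
    simp
  · obtain ⟨d, rfl⟩ := Nat.exists_eq_add_of_lt h
    have hd : k + d + 1 - k = d + 1 := by lia
    have halt := Int.alternating_sum_range_choose_eq_choose (n := d) (m := r)
    have halt' : ∑ i ∈ range (r + 1), (-1 : ℝ) ^ i * ((d + 1).choose i : ℝ) =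
        (-1) ^ r * d.choose r := by exact_mod_cast halt
    rw [hd, halt', if_neg h.ne', zero_sub, abs_neg, abs_mul, abs_mul, abs_pow, abs_neg, abs_one,
      one_pow, one_mul, Nat.abs_cast, Nat.abs_cast]
    gcongr
    lia

/-- A form of the method of factorial moments, for convergence to the Poisson distribution of
mean one. -/
theorem tendsto_of_bonferroni {p : ℕ → ℝ} {E : ℕ → ℕ → ℝ} (k : ℕ)
    (hE : ∀ j, Tendsto (fun n => E n j) atTop (nhds (1 / (j ! : ℝ))))
    (hp : ∀ r, ∀ᶠ n in atTop,
      |p n - ∑ i ∈ range (r + 1), (-1) ^ i * ((k + i).choose k * E n (k + i))| ≤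
        (k + r).choose k * E n (k + r)) :
    Tendsto p atTop (nhds (Real.exp (-1) / (k ! : ℝ))) := by
  have hcoef (i : ℕ) : ((k + i).choose k : ℝ) * (1 / ((k + i)! : ℝ)) = 1 / i ! / k ! := by
    have h := Nat.choose_mul_factorial_mul_factorial (Nat.le_add_right k i)
    rw [Nat.add_sub_cancel_left] at h
    have h' : ((k + i).choose k : ℝ) * k ! * i ! = (k + i)! := by exact_mod_cast h
    rw [← h']
    have : ((k + i).choose k : ℝ) ≠ 0 := by
      exact_mod_cast (Nat.choose_pos (by lia)).ne'
    field_simp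
  have hseries : Tendsto (fun r => ∑ i ∈ range (r + 1), (-1 : ℝ) ^ i * (1 / i ! / k !)) atTop
      (nhds (Real.exp (-1) / k !)) := by
    have h := ((NormedSpace.expSeries_div_hasSum_exp (-1 : ℝ)).div_const (k ! : ℝ)).tendsto_sum_nat
    rw [← Real.exp_eq_exp_ℝ] at h
    refine (h.comp (tendsto_add_atTop_nat 1)).congr fun r => sum_congr rfl fun i _ => ?_
    ring
  have herr : Tendsto (fun r : ℕ => 1 / (r ! : ℝ) / k !) atTop (nhds 0) := by
    simpa using (FloorSemiring.tendsto_pow_div_factorial_atTop (1 : ℝ)).div_const (k ! : ℝ)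
  rw [Metric.tendsto_nhds]
  intro ε hε
  obtain ⟨r, hr₁, hr₂⟩ := ((Metric.tendsto_nhds.1 hseries (ε / 4) (by positivity)).and
    (herr.eventually_lt_const (show 0 < ε / 4 by positivity))).exists
  have hsum : Tendsto
      (fun n => ∑ i ∈ range (r + 1), (-1 : ℝ) ^ i * ((k + i).choose k * E n (k + i))) atTop
      (nhds (∑ i ∈ range (r + 1), (-1 : ℝ) ^ i * (1 / i ! / k !))) := by
    refine tendsto_finsetSum _ fun i _ => ?_
    rw [← hcoef]
    exact ((hE (k + i)).const_mul _).const_mul _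
  have hlast := (hE (k + r)).const_mul ((k + r).choose k : ℝ)
  rw [hcoef] at hlast
  filter_upwards [hp r, Metric.tendsto_nhds.1 hsum (ε / 4) (by positivity),
    hlast.eventually_lt_const hr₂] with n h₁ h₂ h₃
  rw [Real.dist_eq, abs_lt] at *
  rw [abs_le] at h₁
  constructor <;> linarith

end Bonferroni

section Limits

open Finset

theorem tendsto_choose_div_pow (j : ℕ) :
    Tendsto (fun N : ℕ => (N.choose j : ℝ) / (N : ℝ) ^ j) atTop (nhds (1 / (j ! : ℝ))) := by
  have h := (Asymptotics.isEquivalent_iff_tendsto_one (by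
    filter_upwards [eventually_gt_atTop 0] with N hN
    positivity)).1 (isEquivalent_choose j)
  refine (h.div_const (j ! : ℝ)).congr fun N => ?_
  rw [Pi.div_apply, div_div_eq_mul_div, div_right_comm, mul_div_cancel_right₀ _ (by positivity)]

theorem tendsto_prod_div_pow (m : ℕ) :
    Tendsto (fun N : ℕ => ((∏ i ∈ range m, (N - (2 * i + 1)) : ℕ) : ℝ) / (N : ℝ) ^ m) atTop
      (nhds 1) := by
  have hfactor (i : ℕ) : Tendsto (fun N : ℕ => ((N - (2 * i + 1) : ℕ) : ℝ) / N) atTop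
      (nhds 1) := by
    have h := (tendsto_const_div_atTop_nhds_zero_nat (2 * i + 1 : ℝ)).const_sub 1
    rw [sub_zero] at h
    refine h.congr' ?_
    filter_upwards [eventually_ge_atTop (2 * i + 1)] with N hN
    have : (N : ℝ) ≠ 0 := by
      have : 0 < N := by lia
      positivity
    rw [Nat.cast_sub hN]
    push_cast
    field_simp
  have h := tendsto_finsetProd (range m) fun i _ => hfactor i
  simpa [prod_div_distrib] using h

end Limits

section SimpleChords

open Finset

theorem finRotate_ne_self {N : ℕ} (hN : 2 ≤ N) (i : Fin N) : finRotate N i ≠ i := by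
  obtain ⟨N, rfl⟩ := Nat.exists_eq_add_of_le hN
  intro h
  rw [finRotate_apply, add_eq_left] at h
  simp [Fin.ext_iff, Nat.add_comm 2] at h

theorem finRotate_finRotate_ne_self {N : ℕ} (hN : 3 ≤ N) (i : Fin N) :
    finRotate N (finRotate N i) ≠ i := by
  obtain ⟨N, rfl⟩ := Nat.exists_eq_add_of_le hN
  intro h
  rw [finRotate_apply, finRotate_apply, add_assoc, add_eq_left] at h
  simp [Fin.ext_iff, Fin.val_add, Nat.add_comm 3,
    Nat.mod_eq_of_lt (show 2 < N + 3 by lia)] at h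

theorem fpfInvolutions_fin_nonempty (n : ℕ) : (fpfInvolutions (Fin (2 * n))).Nonempty :=
  ⟨Fin.revPerm, mem_fpfInvolutions.2 ⟨fun i => by simp, fun i h => by
    have := congrArg Fin.val h
    simp only [Fin.revPerm_apply, Fin.val_rev] at this
    lia⟩⟩

/-- The `j`-th binomial moment of the number of simple chords. -/
noncomputable def simpleChordsMoment (n j : ℕ) : ℝ :=
  (∑ π ∈ fpfInvolutions (Fin (2 * n)), ((simpleChords π).choose j : ℝ)) /
    #(fpfInvolutions (Fin (2 * n)))

theorem tendsto_card_separated (j : ℕ) :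
    Tendsto (fun N : ℕ => (#(separatedSets (finRotate N) j) : ℝ) / (N : ℝ) ^ j) atTop
      (nhds (1 / (j ! : ℝ))) := by
  cases j with
  | zero => simp [separatedSets, filter_singleton]
  | succ m =>
    have hlow := (tendsto_choose_div_pow (m + 1)).sub
      (((tendsto_choose_div_pow m).mul_const (m : ℝ)).mul
        (tendsto_const_div_atTop_nhds_zero_nat (1 : ℝ)))
    rw [mul_zero, sub_zero] at hlow
    refine tendsto_of_tendsto_of_tendsto_of_le_of_le' hlow (tendsto_choose_div_pow (m + 1)) ?_
      (.of_forall fun N => ?_)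
    · filter_upwards [eventually_ge_atTop 2] with N hN
      have h : (N.choose (m + 1) : ℝ) ≤
          #(separatedSets (finRotate N) (m + 1)) + N.choose m * m := by
        have h := choose_le_card_separatedSets_add (finRotate_ne_self hN) m
        rw [Fintype.card_fin] at h
        exact_mod_cast h
      have hN0 : (0 : ℝ) < N := by positivity
      calc _ = ((N.choose (m + 1) : ℝ) - N.choose m * m) / (N : ℝ) ^ (m + 1) := by
            rw [pow_succ]
            field_simp
        _ ≤ _ := by
            gcongr
            linarith
    · gcongr
      exact (card_separatedSets_le _ _).trans (by rw [Fintype.card_fin])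

theorem tendsto_simpleChordsMoment (j : ℕ) :
    Tendsto (fun n => simpleChordsMoment n j) atTop (nhds (1 / (j ! : ℝ))) := by
  have htwo : Tendsto (fun n : ℕ => 2 * n) atTop atTop :=
    tendsto_id.const_mul_atTop' (by norm_num)
  have h := ((tendsto_card_separated j).div (tendsto_prod_div_pow j) one_ne_zero).comp htwo
  rw [div_one] at h
  refine h.congr' ?_
  filter_upwards [eventually_ge_atTop (j + 2)] with n hn
  have hmom := sum_choose_card_agree (finRotate (2 * n)).injective
    (finRotate_finRotate_ne_self (by lia)) j
  rw [Fintype.card_fin] at hmom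
  have hmom' : ((∏ i ∈ range j, (2 * n - (2 * i + 1)) : ℕ) : ℝ) *
      ∑ π ∈ fpfInvolutions (Fin (2 * n)), ((simpleChords π).choose j : ℝ) =
      #(separatedSets (finRotate (2 * n)) j) * #(fpfInvolutions (Fin (2 * n))) := by
    simp only [simpleChords]
    exact_mod_cast hmom
  have hT : (#(fpfInvolutions (Fin (2 * n))) : ℝ) ≠ 0 := by
    exact_mod_cast (fpfInvolutions_fin_nonempty n).card_pos.ne'
  have hprod : ((∏ i ∈ range j, (2 * n - (2 * i + 1)) : ℕ) : ℝ) ≠ 0 := by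
    rw [Nat.cast_ne_zero, prod_ne_zero_iff]
    intro i hi
    have := mem_range.1 hi
    lia
  have hn0 : ((2 * n : ℕ) : ℝ) ^ j ≠ 0 := by
    have : 0 < 2 * n := by lia
    positivity
  simp only [Function.comp_apply, Pi.div_apply, simpleChordsMoment]
  rw [div_div_div_cancel_right₀ hn0, div_eq_div_iff hprod hT, ← hmom', mul_comm]

theorem uniformCD_toReal (n k : ℕ) :
    ((uniformCD n) {π | simpleChords π = k}).toReal =
      (∑ π ∈ fpfInvolutions (Fin (2 * n)), if simpleChords π = k then (1 : ℝ) else 0) /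
        #(fpfInvolutions (Fin (2 * n))) := by
  have : MeasurableSingletonClass (Equiv.Perm (Fin (2 * n))) := ⟨fun _ => trivial⟩
  have h₁ : {π : Equiv.Perm (Fin (2 * n)) | IsChordDiagram π} =
      (fpfInvolutions (Fin (2 * n)) : Set (Equiv.Perm (Fin (2 * n)))) := by
    ext π
    simp [mem_fpfInvolutions, IsChordDiagram]
  have h₂ : {π : Equiv.Perm (Fin (2 * n)) | simpleChords π = k} =
      ((univ.filter fun π => simpleChords π = k : Finset (Equiv.Perm (Fin (2 * n)))) :
        Set (Equiv.Perm (Fin (2 * n)))) := by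
    ext π
    simp
  rw [uniformCD, h₁, h₂, uniformOn_apply_finset, inter_filter, inter_univ, sum_boole]
  simp

theorem abs_uniformCD_sub_sum_le (n k r : ℕ) :
    |((uniformCD n) {π | simpleChords π = k}).toReal -
      ∑ i ∈ range (r + 1), (-1 : ℝ) ^ i * ((k + i).choose k * simpleChordsMoment n (k + i))| ≤
        (k + r).choose k * simpleChordsMoment n (k + r) := by
  have heq : ((uniformCD n) {π | simpleChords π = k}).toReal -
      ∑ i ∈ range (r + 1), (-1 : ℝ) ^ i * ((k + i).choose k * simpleChordsMoment n (k + i)) =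
      (∑ π ∈ fpfInvolutions (Fin (2 * n)), ((if simpleChords π = k then 1 else 0 : ℝ) -
        ∑ i ∈ range (r + 1), (-1 : ℝ) ^ i * ((k + i).choose k * (simpleChords π).choose (k + i)))) /
        #(fpfInvolutions (Fin (2 * n))) := by
    rw [uniformCD_toReal, sum_sub_distrib, sub_div, sum_comm, sum_div (range (r + 1))]
    congr 1
    refine sum_congr rfl fun i _ => ?_
    rw [← mul_sum, ← mul_sum, simpleChordsMoment, mul_div_assoc, mul_div_assoc]
  rw [heq, abs_div, Nat.abs_cast, simpleChordsMoment, ← mul_div_assoc, mul_sum]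
  gcongr
  exact (abs_sum_le_sum_abs _ _).trans
    (sum_le_sum fun π _ => abs_ite_sub_alternating_sum_choose_le _ k r)

end SimpleChords

/-- The number of simple chords converges in distribution to `Poisson(1)`. -/
theorem simpleChords_poisson_limit (k : ℕ) :
    Tendsto (fun n => ((uniformCD n) {π | simpleChords π = k}).toReal) atTop
      (nhds (Real.exp (-1) / (k : ℕ)!)) :=
  tendsto_of_bonferroni k tendsto_simpleChordsMoment
    fun r => .of_forall fun n => abs_uniformCD_sub_sum_le n k r
end
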